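/- B is a finitely generated A-module and dim_k(B/mB) ≤ dim_k H¹(G, k(χ₁χ₂⁻¹)). -/

import Mathlib

universe u v w

/-- The representation of `G` on `Fin 2 → R` associated to a homomorphism
`ρ : G →* GL₂(R)`. -/
noncomputable def glRep {R : Type*} [CommRing R] {G : Type*} [Group G]
    (ρ : G →* Matrix.GeneralLinearGroup (Fin 2) R) :
    Representation R G (Fin 2 → R) :=
  (Matrix.toLinAlgEquiv' (R := R) (n := Fin 2)).toAlgHom.toRingHom.toMonoidHom.comp
    ((Units.coeHom (Matrix (Fin 2) (Fin 2) R)).comp ρ)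

/-- The `1`-cocycles of `G` with values in the one-dimensional representation `k(χ)`
of a character `χ : G → kˣ` (i.e. `g` acts on `k` by multiplication by `χ(g)`). -/
def oneCocyclesChar {k : Type*} [CommRing k] {G : Type*} [Group G] (χ : G →* kˣ) :
    Submodule k (G → k) where
  carrier := {f | ∀ g h : G, f (g * h) = f g + (χ g : k) * f h}
  add_mem' := by
    intro f₁ f₂ h₁ h₂ g h
    simp only [Pi.add_apply, h₁ g h, h₂ g h]
    ring
  zero_mem' := by intro g h; simp
  smul_mem' := by
    intro c f hf g h
    simp only [Pi.smul_apply, smul_eq_mul, hf g h]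
    ring

/-- The `1`-coboundaries of `G` with values in `k(χ)`. -/
def oneCoboundariesChar {k : Type*} [CommRing k] {G : Type*} [Group G] (χ : G →* kˣ) :
    Submodule k (G → k) :=
  Submodule.span k {f | ∃ x : k, f = fun g => (χ g : k) * x - x}

/-- `H¹(G, k(χ))`, the first group cohomology of the character `χ`;
one has `Ext¹_{k[G]}(χ₂, χ₁) ≅ H¹(G, k(χ₁χ₂⁻¹))`. -/
abbrev H1Char {k : Type*} [CommRing k] {G : Type*} [Group G] (χ : G →* kˣ) :=
  ↥(oneCocyclesChar χ) ⧸
    Submodule.comap (oneCocyclesChar χ).subtype (oneCoboundariesChar χ)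

open IsLocalRing in
/-- If `ρ(s)` is diagonal with entries in `A` whose difference is a unit, and the traces of `ρ`
lie in `A` and reduce to `χ₁ + χ₂`, then the diagonal entries of `ρ` lie in `A` and reduce to
`χ₁` and `χ₂`. -/
lemma exists_lift_diagonal_entries {G A K : Type*} [Group G] [CommRing A] [CommRing K]
    [IsLocalRing A] [Algebra A K] (ρ : G →* Matrix.GeneralLinearGroup (Fin 2) K) (T : G → A)
    (hT : ∀ g, algebraMap A K (T g) = Matrix.trace (ρ g : Matrix (Fin 2) (Fin 2) K))
    (χ₁ χ₂ : G →* (ResidueField A)ˣ)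
    (hTχ : ∀ g, residue A (T g) = (χ₁ g : ResidueField A) + (χ₂ g : ResidueField A))
    (s : G) (hs : χ₁ s ≠ χ₂ s) (l₁ l₂ : A)
    (hl₁ : residue A l₁ = χ₁ s) (hl₂ : residue A l₂ = χ₂ s)
    (hρs : (ρ s : Matrix (Fin 2) (Fin 2) K)
      = Matrix.diagonal ![algebraMap A K l₁, algebraMap A K l₂]) (g : G) :
    ∃ x y : A, algebraMap A K x = (ρ g : Matrix (Fin 2) (Fin 2) K) 0 0 ∧
      algebraMap A K y = (ρ g : Matrix (Fin 2) (Fin 2) K) 1 1 ∧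
      residue A x = χ₁ g ∧ residue A y = χ₂ g := by
  have hne : (χ₁ s : ResidueField A) - χ₂ s ≠ 0 := by
    rwa [sub_ne_zero, Ne, Units.ext_iff.symm]
  have hu : IsUnit (l₁ - l₂) := by
    rw [← residue_ne_zero_iff_isUnit, map_sub, hl₁, hl₂]
    exact hne
  obtain ⟨u, hu⟩ := hu.exists_left_inv
  have hg := hT g
  have hsg := hT (s * g)
  rw [map_mul, Units.val_mul, hρs, Matrix.trace_fin_two] at hsg
  simp only [Matrix.diagonal_mul, Matrix.cons_val_zero, Matrix.cons_val_one] at hsg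
  rw [Matrix.trace_fin_two] at hg
  have huK := congrArg (algebraMap A K) hu
  have huk := congrArg (residue A) hu
  simp only [map_mul, map_sub, map_one, hl₁, hl₂] at huK huk
  refine ⟨u * (T (s * g) - l₂ * T g), u * (l₁ * T g - T (s * g)), ?_, ?_, ?_, ?_⟩
  · simp only [map_mul, map_sub, hg, hsg]
    linear_combination ((ρ g : Matrix (Fin 2) (Fin 2) K) 0 0) * huK
  · simp only [map_mul, map_sub, hg, hsg]
    linear_combination ((ρ g : Matrix (Fin 2) (Fin 2) K) 1 1) * huK
  · simp only [map_mul, map_sub, hTχ, hl₂, Units.val_mul]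
    linear_combination (χ₁ g : ResidueField A) * huk
  · simp only [map_mul, map_sub, hTχ, hl₁, Units.val_mul]
    linear_combination (χ₂ g : ResidueField A) * huk

/-- A semisimple two-dimensional representation which is upper triangular, and whose image
contains a diagonal matrix with distinct eigenvalues, is diagonal. -/
lemma upper_right_eq_zero_of_isSemisimpleModule {G F : Type*} [Group G] [Field F]
    (σ : G →* Matrix.GeneralLinearGroup (Fin 2) F)
    [hss : IsSemisimpleModule (MonoidAlgebra F G) (glRep σ).asModule]
    (s : G) (x y : F) (hxy : x ≠ y)
    (hs : (σ s : Matrix (Fin 2) (Fin 2) F) = Matrix.diagonal ![x, y])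
    (hc : ∀ g, (σ g : Matrix (Fin 2) (Fin 2) F) 1 0 = 0) (g : G) :
    (σ g : Matrix (Fin 2) (Fin 2) F) 0 1 = 0 := by
  have happ (g : G) (v : Fin 2 → F) :
      glRep σ g v = (σ g : Matrix (Fin 2) (Fin 2) F).mulVec v := rfl
  let W : Subrepresentation (glRep σ) :=
    { toSubmodule := LinearMap.ker (LinearMap.proj (R := F) (φ := fun _ : Fin 2 => F) 1)
      apply_mem_toSubmodule := by
        intro g v hv
        simp only [LinearMap.mem_ker, LinearMap.proj_apply] at hv ⊢
        simp [happ, Matrix.mulVec, dotProduct, Fin.sum_univ_two, hv, hc] }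
  have hWmem (v : Fin 2 → F) : v ∈ W.toSubmodule ↔ v 1 = 0 := Iff.rfl
  obtain ⟨N, hN⟩ := exists_isCompl (Subrepresentation.asSubmodule W)
  let W' := Subrepresentation.ofSubmodule' N
  have hdisj (v : Fin 2 → F) (h0 : v 1 = 0) (h' : v ∈ W'.toSubmodule) : v = 0 :=
    Submodule.disjoint_def.mp hN.disjoint ((glRep σ).asModuleEquiv.symm v) h0 h'
  obtain ⟨w, hw, w', hw', hsum⟩ : ∃ w : Fin 2 → F, w 1 = 0 ∧
      ∃ w' ∈ W'.toSubmodule, w + w' = ![0, 1] := by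
    have htop : (glRep σ).asModuleEquiv.symm ![0, 1] ∈ Subrepresentation.asSubmodule W ⊔ N := by
      rw [hN.sup_eq_top]
      exact Submodule.mem_top
    obtain ⟨w, hw, w', hw', h⟩ := Submodule.mem_sup.mp htop
    exact ⟨w, hw, w', hw', h⟩
  have h1 : w' 1 = 1 := by simpa [hw] using congrFun hsum 1
  have h0 : w' 0 = 0 := by
    have hmem := W'.toSubmodule.sub_mem (W'.apply_mem_toSubmodule s hw')
      (W'.toSubmodule.smul_mem y hw')
    have := congrFun (hdisj _ (by simp [happ, hs]) hmem) 0
    simp only [happ, hs, Matrix.mulVec_diagonal, Pi.sub_apply, Pi.smul_apply, smul_eq_mul,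
      Matrix.cons_val_zero, Pi.zero_apply, ← sub_mul] at this
    exact (mul_eq_zero.mp this).resolve_left (sub_ne_zero.mpr hxy)
  have hmem := W'.toSubmodule.sub_mem (W'.apply_mem_toSubmodule g hw')
    (W'.toSubmodule.smul_mem ((σ g : Matrix (Fin 2) (Fin 2) F) 1 1) hw')
  have := congrFun (hdisj _ (by simp [happ, Matrix.mulVec_eq_sum, h0, h1]) hmem) 0
  simpa [happ, Matrix.mulVec, dotProduct, Fin.sum_univ_two, h0, h1] using this

/-- If a submodule `B` of `K` is mapped into `A` by multiplication by each of finitely many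
elements whose common annihilator in `B` is zero, then `B` is finitely generated. -/
lemma Submodule.fg_of_mul_mem_range {A K ι : Type*} [CommRing A] [IsNoetherianRing A] [CommRing K]
    [Algebra A K] (hinj : Function.Injective (algebraMap A K)) [Finite ι] (B : Submodule A K)
    (c : ι → K) (hBc : ∀ i, ∀ x ∈ B, x * c i ∈ Set.range (algebraMap A K))
    (hB : ∀ x ∈ B, (∀ i, x * c i = 0) → x = 0) : B.FG := by
  let φ : B →ₗ[A] (ι → K) := (LinearMap.pi fun i => LinearMap.mulRight A (c i)) ∘ₗ B.subtype
  let j : (ι → A) →ₗ[A] (ι → K) := LinearMap.compLeft (Algebra.linearMap A K) ι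
  have hj : Function.Injective j := fun f g h => funext fun i => hinj (congrFun h i)
  have hφj (x : B) : φ x ∈ LinearMap.range j := by
    choose f hf using fun i => hBc i x x.2
    exact ⟨f, funext hf⟩
  have hφ : Function.Injective (φ.codRestrict (LinearMap.range j) hφj) := by
    refine (injective_iff_map_eq_zero _).mpr fun x hx => Subtype.ext (hB x x.2 fun i => ?_)
    exact congrFun (congrArg Subtype.val hx) i
  have : IsNoetherian A (LinearMap.range j) :=
    isNoetherian_of_linearEquiv (LinearEquiv.ofInjective j hj)
  have : IsNoetherian A B := isNoetherian_of_injective _ hφ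
  exact Module.Finite.iff_fg.mp inferInstance

/-- If `b : G → V` spans `V`, vanishes at an element separating `χ₁` from `χ₂` and satisfies
`b (g * h) = χ₁ g • b h + χ₂ h • b g`, then the linear forms on `V` embed
into `H¹(G, k(χ₁χ₂⁻¹))`. -/
lemma lift_rank_le_rank_H1Char {G : Type u} [Group G] {k : Type v} [Field k] {V : Type w}
    [AddCommGroup V] [Module k V] [Module.Finite k V] (χ₁ χ₂ : G →* kˣ) (b : G → V)
    (hspan : Submodule.span k (Set.range b) = ⊤)
    (hb : ∀ g h, b (g * h) = (χ₁ g : k) • b h + (χ₂ h : k) • b g)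
    (s : G) (hs : χ₁ s ≠ χ₂ s) (hbs : b s = 0) :
    Cardinal.lift.{max u v} (Module.rank k V) ≤
      Cardinal.lift.{w} (Module.rank k (H1Char (χ₁ * χ₂⁻¹))) := by
  let Φ : Module.Dual k V →ₗ[k] oneCocyclesChar (χ₁ * χ₂⁻¹) :=
    { toFun := fun f => ⟨fun g => (χ₂ g : k)⁻¹ * f (b g), fun g h => by
        have h₁ := (χ₂ g).ne_zero
        have h₂ := (χ₂ h).ne_zero
        simp only [hb, map_add, map_smul, smul_eq_mul, map_mul, Units.val_mul,
          MonoidHom.mul_apply, MonoidHom.inv_apply, Units.val_inv_eq_inv_val]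
        field_simp
        ring⟩
      map_add' := fun f₁ f₂ => by ext g; simp [mul_add]
      map_smul' := fun c f => by ext g; simp [mul_left_comm] }
  have hΦ : Function.Injective ((Submodule.mkQ (Submodule.comap
      (oneCocyclesChar (χ₁ * χ₂⁻¹)).subtype (oneCoboundariesChar (χ₁ * χ₂⁻¹)))) ∘ₗ Φ) := by
    refine (injective_iff_map_eq_zero _).mpr fun f hf => ?_
    have hf' : (Φ f : G → k) ∈ oneCoboundariesChar (χ₁ * χ₂⁻¹) := by
      simpa using hf
    obtain ⟨x, hx⟩ : ∃ x : k, (Φ f : G → k) =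
        fun g => ((χ₁ * χ₂⁻¹) g : k) * x - x := by
      refine Submodule.span_induction (p := fun F _ => ∃ x : k, F =
        fun g => ((χ₁ * χ₂⁻¹) g : k) * x - x) (fun _ h => h) ⟨0, by ext; simp⟩ ?_ ?_ hf'
      · rintro _ _ _ _ ⟨x, rfl⟩ ⟨y, rfl⟩
        exact ⟨x + y, by ext; simp only [Pi.add_apply]; ring⟩
      · rintro c _ _ ⟨x, rfl⟩
        exact ⟨c * x, by ext; simp only [Pi.smul_apply, smul_eq_mul]; ring⟩
    have hΦf (g : G) : (Φ f : G → k) g = (χ₂ g : k)⁻¹ * f (b g) := rfl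
    have hx0 : x = 0 := by
      have := congrFun hx s
      rw [hΦf, hbs, map_zero, mul_zero, eq_comm, ← sub_one_mul] at this
      refine (mul_eq_zero.mp this).resolve_left fun h => hs ?_
      rw [sub_eq_zero, Units.val_eq_one] at h
      simpa [mul_inv_eq_one] using h
    refine LinearMap.ext_on_range hspan fun g => ?_
    have := congrFun hx g
    rw [hΦf, hx0] at this
    simpa using this
  have hle := LinearMap.lift_rank_le_of_injective _ hΦ
  rw [← Module.finrank_eq_rank, Subspace.dual_finrank_eq] at hle
  rw [← Module.finrank_eq_rank, Cardinal.lift_natCast]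
  simpa using hle

open IsLocalRing in
/-- If a finite module `M` over a local ring `A` is generated by elements `b g` with
`b (g * h) = α g • b h + δ h • b g`, where `α` and `δ` reduce to the characters `χ₁` and `χ₂`,
and `b` vanishes at an element separating `χ₁` from `χ₂`, then the dimension of `M / 𝔪M` is at
most that of `H¹(G, k(χ₁χ₂⁻¹))`. -/
lemma lift_rank_quotient_le_rank_H1Char {G : Type u} [Group G] {A : Type v} [CommRing A]
    [IsLocalRing A] {M : Type w} [AddCommGroup M] [Module A M] [Module.Finite A M]
    (χ₁ χ₂ : G →* (ResidueField A)ˣ) (α δ : G → A)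
    (hα : ∀ g, residue A (α g) = χ₁ g) (hδ : ∀ g, residue A (δ g) = χ₂ g) (b : G → M)
    (hspan : Submodule.span A (Set.range b) = ⊤)
    (hb : ∀ g h, b (g * h) = α g • b h + δ h • b g)
    (s : G) (hs : χ₁ s ≠ χ₂ s) (hbs : b s = 0) :
    Cardinal.lift.{max u v} (Module.rank (A ⧸ maximalIdeal A)
        (M ⧸ (maximalIdeal A • (⊤ : Submodule A M)))) ≤
      Cardinal.lift.{w} (Module.rank (ResidueField A) (H1Char (χ₁ * χ₂⁻¹))) := by
  let modV : Module (ResidueField A) (M ⧸ (maximalIdeal A • (⊤ : Submodule A M))) :=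
    (inferInstance : Module (A ⧸ maximalIdeal A) (M ⧸ (maximalIdeal A • (⊤ : Submodule A M))))
  have hsmul (a : A) (v : M ⧸ (maximalIdeal A • (⊤ : Submodule A M))) :
      residue A a • v = a • v := rfl
  have : IsScalarTower A (ResidueField A) (M ⧸ (maximalIdeal A • (⊤ : Submodule A M))) :=
    IsScalarTower.of_algebraMap_smul hsmul
  have : Module.Finite (ResidueField A) (M ⧸ (maximalIdeal A • (⊤ : Submodule A M))) :=
    Module.Finite.of_restrictScalars_finite A _ _
  refine lift_rank_le_rank_H1Char χ₁ χ₂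
    (fun g => Submodule.mkQ (maximalIdeal A • (⊤ : Submodule A M)) (b g)) ?_ ?_ s hs ?_
  · refine Submodule.eq_top_iff'.mpr fun v => ?_
    obtain ⟨x, rfl⟩ := Submodule.mkQ_surjective _ v
    have hx : x ∈ Submodule.span A (Set.range b) := hspan ▸ Submodule.mem_top
    have := Submodule.mem_map_of_mem (f := Submodule.mkQ (maximalIdeal A • (⊤ : Submodule A M))) hx
    rw [Submodule.map_span, ← Set.range_comp] at this
    exact Submodule.span_le_restrictScalars A (ResidueField A) _ this
  · intro g h
    rw [← hα, ← hδ, hsmul, hsmul, hb, map_add, map_smul, map_smul]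
  · simp only [hbs, map_zero]

/-- Mazur–Wiles: `B` is a finitely generated `A`-module and
`dim_k(B/mB) ≤ dim_k H¹(G, k(χ₁χ₂⁻¹))`. -/
theorem B_fg_and_rank_le_dim_H1
    {G : Type u} [Group G]
    {A : Type v} {K : Type w} [CommRing A] [CommRing K] [IsReduced A] [IsNoetherianRing A] [IsLocalRing A]
    [HenselianLocalRing A] [CharZero K] [Algebra A K]
    [IsLocalization (nonZeroDivisors A) K]
    (ρ : G →* Matrix.GeneralLinearGroup (Fin 2) K)
    (T dt : G → A)
    (hT : ∀ g, algebraMap A K (T g) = Matrix.trace (ρ g : Matrix (Fin 2) (Fin 2) K))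
    (hdt : ∀ g, algebraMap A K (dt g) = Matrix.det (ρ g : Matrix (Fin 2) (Fin 2) K))
    (χ₁ χ₂ : G →* (IsLocalRing.ResidueField A)ˣ)
    (hχ : χ₁ ≠ χ₂)
    (hTχ : ∀ g, IsLocalRing.residue A (T g)
      = (χ₁ g : IsLocalRing.ResidueField A) + (χ₂ g : IsLocalRing.ResidueField A))
    (s : G) (hs : χ₁ s ≠ χ₂ s)
    (lam₁ lam₂ : Aˣ)
    (hlam₁ : IsLocalRing.residue A (lam₁ : A) = χ₁ s)
    (hlam₂ : IsLocalRing.residue A (lam₂ : A) = χ₂ s)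
    (hρs : (ρ s : Matrix (Fin 2) (Fin 2) K)
      = Matrix.diagonal ![algebraMap A K (lam₁ : A), algebraMap A K (lam₂ : A)])
    {r : ℕ} (Kj : Fin r → Type*) [∀ j, Field (Kj j)]
    (e : K ≃+* ((j : Fin r) → Kj j))
    (hss : ∀ j : Fin r,
      IsSemisimpleModule (MonoidAlgebra (Kj j) G)
        (glRep ((Units.map
          (((Pi.evalRingHom Kj j).comp e.toRingHom).mapMatrix.toMonoidHom)).comp ρ)).asModule)
    :
    (Submodule.span A
      (Set.range fun h : G => (ρ h : Matrix (Fin 2) (Fin 2) K) 0 1)).FG ∧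
    Cardinal.lift.{max u v} (Module.rank (A ⧸ IsLocalRing.maximalIdeal A)
        (↥(Submodule.span A (Set.range fun h : G => (ρ h : Matrix (Fin 2) (Fin 2) K) 0 1)) ⧸
          (IsLocalRing.maximalIdeal A •
            (⊤ : Submodule A
              ↥(Submodule.span A
                (Set.range fun h : G => (ρ h : Matrix (Fin 2) (Fin 2) K) 0 1)))))
      )
      ≤ Cardinal.lift.{w} (Module.rank (IsLocalRing.ResidueField A) (H1Char (χ₁ * χ₂⁻¹))) := by
  choose α δ hα hδ hαχ hδχ using exists_lift_diagonal_entries ρ T hT χ₁ χ₂ hTχ s hs lam₁ lam₂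
    hlam₁ hlam₂ hρs
  set b : G → K := fun h => (ρ h : Matrix (Fin 2) (Fin 2) K) 0 1 with hbdef
  set B : Submodule A K := Submodule.span A (Set.range b)
  have hbmem (g : G) : b g ∈ B := Submodule.subset_span ⟨g, rfl⟩
  have hbmul (g h : G) : b (g * h) = α g • b h + δ h • b g := by
    simp only [hbdef, map_mul, Units.val_mul, Matrix.mul_apply, Fin.sum_univ_two,
      Algebra.smul_def, hα, hδ]
    ring
  have hbs : b s = 0 := by simp [hbdef, hρs]
  have hinj : Function.Injective (algebraMap A K) :=
    IsLocalization.injective K (le_refl (nonZeroDivisors A))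
  have hbc (h : G) (x : K) (hx : x ∈ B) :
      x * (ρ h : Matrix (Fin 2) (Fin 2) K) 1 0 ∈ Set.range (algebraMap A K) := by
    suffices B ≤ Submodule.comap (LinearMap.mulRight A ((ρ h : Matrix (Fin 2) (Fin 2) K) 1 0))
        (LinearMap.range (Algebra.linearMap A K)) from this hx
    refine Submodule.span_le.mpr ?_
    rintro _ ⟨g, rfl⟩
    refine ⟨α (g * h) - α g * α h, ?_⟩
    simp only [Algebra.linearMap_apply, map_sub, map_mul, hα, Units.val_mul, Matrix.mul_apply,
      Fin.sum_univ_two, LinearMap.mulRight_apply, hbdef]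
    ring
  have hsep (j : Fin r) : ∃ h : G, ∀ g : G,
      e ((ρ h : Matrix (Fin 2) (Fin 2) K) 1 0) j = 0 → e (b g) j = 0 := by
    by_cases hc : ∃ h : G, e ((ρ h : Matrix (Fin 2) (Fin 2) K) 1 0) j ≠ 0
    · exact hc.imp fun h hh _ h0 => absurd h0 hh
    push Not at hc
    have := hss j
    refine ⟨1, fun g _ => upper_right_eq_zero_of_isSemisimpleModule
      ((Units.map (((Pi.evalRingHom Kj j).comp e.toRingHom).mapMatrix.toMonoidHom)).comp ρ) s
      (e (algebraMap A K lam₁) j) (e (algebraMap A K lam₂) j) ?_ ?_ hc g⟩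
    · have hu : IsUnit ((lam₁ : A) - lam₂) := by
        rw [← IsLocalRing.residue_ne_zero_iff_isUnit, map_sub, hlam₁, hlam₂, sub_ne_zero]
        exact fun h => hs (Units.ext h)
      have := (hu.map (((Pi.evalRingHom Kj j).comp e.toRingHom).comp (algebraMap A K))).ne_zero
      rw [map_sub, sub_ne_zero] at this
      exact this
    · ext i l
      change e ((ρ s : Matrix (Fin 2) (Fin 2) K) i l) j = _
      rw [hρs]
      fin_cases i <;> fin_cases l <;> simp
  choose hj hhj using hsep
  have hfg : B.FG := by
    refine Submodule.fg_of_mul_mem_range hinj B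
      (fun j => (ρ (hj j) : Matrix (Fin 2) (Fin 2) K) 1 0) (fun j => hbc (hj j)) ?_
    intro x hx h0
    refine e.injective (funext fun j => ?_)
    have hxj : e x j * e ((ρ (hj j) : Matrix (Fin 2) (Fin 2) K) 1 0) j = 0 := by
      simpa using congrFun (congrArg e (h0 j)) j
    rw [map_zero, Pi.zero_apply]
    refine (mul_eq_zero.mp hxj).elim id fun hc => ?_
    refine Submodule.span_induction (p := fun y _ => e y j = 0) ?_ (by simp) ?_ ?_ hx
    · rintro _ ⟨g, rfl⟩
      exact hhj j g hc
    · intro y z _ _ hy hz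
      simp [hy, hz]
    · intro a y _ hy
      simp [Algebra.smul_def, hy]
  refine ⟨hfg, ?_⟩
  have : Module.Finite A B := Module.Finite.iff_fg.mpr hfg
  refine lift_rank_quotient_le_rank_H1Char χ₁ χ₂ α δ hαχ hδχ (fun g => (⟨b g, hbmem g⟩ : B)) ?_
    (fun g h => Subtype.ext (hbmul g h)) s hs (Subtype.ext hbs)
  refine Submodule.map_injective_of_injective B.injective_subtype ?_
  rw [Submodule.map_span, ← Set.range_comp, Submodule.map_subtype_top]
  rfl
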